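/- arXiv:2602.01454 — 4 statements merged into one kernel-verified Lean document; each statement's English description precedes it below -/
import Mathlib

section
/- With the complete-graph setup below, for every pair of indices i, j, the j-th coordinate of the point of view of node i at level m converges to P j as m → ∞; that is, the sequence m ↦ M_m i j / (∑ k, M_m i k) tends to P j as m → ∞. -/
open Filter

/-- Complete-graph setup: `n ≥ 2`, `P` a categorical distribution with positive entries,
`W i j = P j / (1 - P j)` for `i ≠ j` and `0` on the diagonal, `M_m = (I + W)^m - I`.
Then for every pair of nodes `i, j`, the `j`-th coordinate of the point of view of node `i`
at level `m`, namely `M_m i j / ∑ k, M_m i k`, tends to `P j` as `m → ∞`. -/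
theorem pov_node_tendsto_of_complete (n : ℕ) (hn : 2 ≤ n) (P : Fin n → ℝ)
    (hP : ∀ j, 0 < P j) (hPsum : ∑ j, P j = 1)
    (W : Matrix (Fin n) (Fin n) ℝ)
    (hW : ∀ i j, W i j = if i ≠ j then P j / (1 - P j) else 0)
    (i j : Fin n) :
    Tendsto (fun m : ℕ =>
        ((1 + W) ^ m - 1) i j / ∑ k, ((1 + W) ^ m - 1) i k)
      atTop (nhds (P j)) := by
  have hlt : ∀ k, P k < 1 := by
    intro k
    have : Nontrivial (Fin n) := Fin.nontrivial_iff_two_le.mpr hn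
    obtain ⟨l, hl⟩ := exists_ne k
    have h1 : P k + P l ≤ ∑ j, P j := by
      rw [← Finset.sum_pair hl.symm]
      exact Finset.sum_le_sum_of_subset_of_nonneg (Finset.subset_univ _)
        (fun a _ _ => (hP a).le)
    have := hP l
    linarith
  obtain ⟨c, hc⟩ : ∃ c : ℝ, c = ∑ k, P k * (1 - P k) := ⟨_, rfl⟩
  have hc0 : 0 < c := by
    rw [hc]
    exact Finset.sum_pos (fun k _ => mul_pos (hP k) (by linarith [hlt k])) ⟨i, Finset.mem_univ _⟩
  have hc1 : c ≤ 1 := by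
    rw [hc, ← hPsum]
    exact Finset.sum_le_sum (fun k _ => by nlinarith [hP k, hlt k])
  obtain ⟨u, hu⟩ : ∃ u : Fin n → ℝ, ∀ k, u k = (1 - P k) / c := ⟨fun k => _, fun k => rfl⟩
  have hu0 : ∀ k, 0 < u k := fun k => by
    rw [hu]; exact div_pos (by linarith [hlt k]) hc0
  have hPu : ∑ k, P k * u k = 1 := by
    simp only [hu, mul_div_assoc']
    rw [← Finset.sum_div, ← hc, div_self hc0.ne']
  obtain ⟨B, hB⟩ : ∃ B : Matrix (Fin n) (Fin n) ℝ, B = (1 / 2 : ℝ) • (1 + W) := ⟨_, rfl⟩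
  obtain ⟨R, hR⟩ : ∃ R : Matrix (Fin n) (Fin n) ℝ, ∀ a b, R a b = u a * P b :=
    ⟨fun a b => u a * P b, fun _ _ => rfl⟩
  have hWq : ∀ a b, W a b = P b / (1 - P b) - if a = b then P b / (1 - P b) else 0 := by
    intro a b
    rw [hW]
    by_cases h : a = b <;> simp [h]
  have hPW : ∀ b, ∑ k, P k * W k b = P b := by
    intro b
    have h1 : 1 - P b ≠ 0 := by linarith [hlt b]
    simp only [hWq, mul_sub, Finset.sum_sub_distrib, ← Finset.sum_mul, hPsum, mul_ite, mul_zero,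
      Finset.sum_ite_eq', Finset.mem_univ, if_true]
    field_simp
  have hWu : ∀ a, ∑ k, W a k * u k = u a := by
    intro a
    have h2 : ∀ k, P k / (1 - P k) * u k = P k / c := by
      intro k
      have h1 : 1 - P k ≠ 0 := by linarith [hlt k]
      rw [hu]; field_simp
    simp only [hWq, sub_mul, Finset.sum_sub_distrib, ite_mul, zero_mul,
      Finset.sum_ite_eq, Finset.mem_univ, if_true, h2, ← Finset.sum_div, hPsum]
    rw [hu, sub_div]
  have hBe : ∀ a b, B a b = 1 / 2 * ((if a = b then 1 else 0) + W a b) := by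
    intro a b
    rw [hB, Matrix.smul_apply, Matrix.add_apply, Matrix.one_apply, smul_eq_mul]
  have hRB : R * B = R := by
    ext a b
    have : ∀ k, R a k * B k b = u a / 2 * ((P k * if k = b then 1 else 0) + P k * W k b) := by
      intro k; rw [hR, hBe]; ring
    rw [Matrix.mul_apply]
    simp only [this, ← Finset.mul_sum, Finset.sum_add_distrib, hPW]
    simp [hR]; ring
  have hBu : ∀ a, ∑ k, B a k * u k = u a := by
    intro a
    have : ∀ k, B a k * u k = 1 / 2 * ((if a = k then u k else 0) + W a k * u k) := by
      intro k; rw [hBe]; split_ifs <;> ring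
    simp only [this, ← Finset.mul_sum, Finset.sum_add_distrib, hWu]
    simp; ring
  have hBR : B * R = R := by
    ext a b
    rw [Matrix.mul_apply]
    simp only [hR, ← mul_assoc, ← Finset.sum_mul, hBu]
  have hRu : ∀ a, ∑ k, R a k * u k = u a := by
    intro a
    simp only [hR, mul_assoc, ← Finset.mul_sum, hPu, mul_one]
  have hRR : R * R = R := by
    ext a b
    rw [Matrix.mul_apply]
    have : ∀ k, R a k * R k b = (R a k * u k) * P b := by
      intro k; rw [hR k b]; ring
    simp only [this, ← Finset.sum_mul, hRu]
    rw [hR]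
  obtain ⟨N, hN⟩ : ∃ N : Matrix (Fin n) (Fin n) ℝ, N = B - (c / 2) • R := ⟨_, rfl⟩
  have hN0 : ∀ a b, 0 ≤ N a b := by
    intro a b
    have e : N a b = B a b - (1 - P a) * P b / 2 := by
      simp only [hN, Matrix.sub_apply, Matrix.smul_apply, smul_eq_mul, hR, hu]
      field_simp
    rw [e, hBe, hW]
    have h1 := hlt a
    have h2 := hlt b
    have h3 := hP a
    have h4 := hP b
    by_cases h : a = b
    · simp only [h, if_true, ne_eq, not_true, if_false]
      nlinarith
    · simp only [h, if_false, ne_eq, not_false_eq_true, if_true]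
      have : P b ≤ P b / (1 - P b) := by
        rw [le_div_iff₀ (by linarith)]; nlinarith
      nlinarith
  have hNu : ∀ a, ∑ k, N a k * u k = (1 - c / 2) * u a := by
    intro a
    simp only [hN, Matrix.sub_apply, Matrix.smul_apply, smul_eq_mul, sub_mul,
      Finset.sum_sub_distrib, mul_assoc, ← Finset.mul_sum, hBu, hRu, one_mul]
  have hRBm : ∀ m : ℕ, R * B ^ m = R := by
    intro m
    induction m with
    | zero => simp
    | succ m ih => rw [pow_succ, ← mul_assoc, ih, hRB]
  have hNR : N * R = (1 - c / 2) • R := by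
    rw [hN, sub_mul, hBR, smul_mul_assoc, hRR, sub_smul, one_smul]
  have hNm : ∀ m : ℕ, B ^ m = N ^ m + (1 - (1 - c / 2) ^ m) • R := by
    intro m
    induction m with
    | zero => simp
    | succ m ih =>
      have e1 : N ^ (m + 1) = N * (B ^ m - (1 - (1 - c / 2) ^ m) • R) := by
        rw [pow_succ', ih, add_sub_cancel_right]
      have e2 : N * B ^ m = B ^ (m + 1) - (c / 2) • R := by
        rw [hN, sub_mul, smul_mul_assoc, hRBm, pow_succ']
      rw [e1, mul_sub, e2, mul_smul_comm, hNR]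
      module
  have hNm0 : ∀ (m : ℕ), (∀ a b, 0 ≤ (N ^ m) a b) ∧
      ∀ a, ∑ k, (N ^ m) a k * u k = (1 - c / 2) ^ m * u a := by
    intro m
    induction m with
    | zero => 
      refine ⟨fun a b => ?_, fun a => ?_⟩
      · rw [pow_zero, Matrix.one_apply]; split_ifs <;> norm_num
      · simp [Matrix.one_apply]
    | succ m ih =>
      refine ⟨fun a b => ?_, fun a => ?_⟩
      · rw [pow_succ, Matrix.mul_apply]
        exact Finset.sum_nonneg (fun k _ => mul_nonneg (ih.1 _ _) (hN0 _ _))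
      · simp only [pow_succ, Matrix.mul_apply, Finset.sum_mul]
        rw [Finset.sum_comm]
        simp only [mul_assoc, ← Finset.mul_sum, hNu]
        have : ∀ k, (N ^ m) a k * ((1 - c / 2) * u k) = (1 - c / 2) * ((N ^ m) a k * u k) := by
          intro k; ring
        simp only [this, ← Finset.mul_sum, ih.2]
        ring
  have hgeo : Tendsto (fun m : ℕ => (1 - c / 2) ^ m) atTop (nhds 0) :=
    tendsto_pow_atTop_nhds_zero_of_lt_one (by linarith) (by linarith)
  have hNt : ∀ b, Tendsto (fun m : ℕ => (N ^ m) i b) atTop (nhds 0) := by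
    intro b
    have hg : Tendsto (fun m : ℕ => (1 - c / 2) ^ m * (u i / u b)) atTop (nhds 0) := by
      simpa using hgeo.mul_const (u i / u b)
    refine squeeze_zero (fun m => (hNm0 m).1 i b) (fun m => ?_) hg
    rw [← mul_div_assoc, le_div_iff₀ (hu0 b), ← (hNm0 m).2 i]
    exact Finset.single_le_sum (f := fun k => (N ^ m) i k * u k)
      (fun k _ => mul_nonneg ((hNm0 m).1 i k) (hu0 k).le) (Finset.mem_univ b)
  have hhalf : Tendsto (fun m : ℕ => (1 / 2 : ℝ) ^ m) atTop (nhds 0) :=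
    tendsto_pow_atTop_nhds_zero_of_lt_one (by norm_num) (by norm_num)
  have hent : ∀ b, Tendsto (fun m : ℕ => (1 / 2 : ℝ) ^ m * ((1 + W) ^ m - 1) i b) atTop
      (nhds (u i * P b)) := by
    intro b
    have e : ∀ m : ℕ, (1 / 2 : ℝ) ^ m * ((1 + W) ^ m - 1) i b
        = (N ^ m) i b + (1 - (1 - c / 2) ^ m) * (u i * P b)
          - (1 / 2 : ℝ) ^ m * (1 : Matrix (Fin n) (Fin n) ℝ) i b := by
      intro m
      have h := congrFun (congrFun (hNm m) i) b
      rw [hB, smul_pow] at h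
      simp only [Matrix.add_apply, Matrix.smul_apply, smul_eq_mul, hR] at h
      rw [Matrix.sub_apply, mul_sub, h]
    simp only [e]
    have := ((hNt b).add ((hgeo.const_sub 1).mul_const (u i * P b))).sub
      (hhalf.mul_const ((1 : Matrix (Fin n) (Fin n) ℝ) i b))
    simpa using this
  have hsum : Tendsto (fun m : ℕ => ∑ k, (1 / 2 : ℝ) ^ m * ((1 + W) ^ m - 1) i k) atTop
      (nhds (u i)) := by
    have := tendsto_finsetSum Finset.univ (fun k _ => hent k)
    rwa [← Finset.mul_sum, hPsum, mul_one] at this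
  have hfin := (hent j).div hsum (hu0 i).ne'
  rw [mul_div_cancel_left₀ _ (hu0 i).ne'] at hfin
  refine hfin.congr (fun m => ?_)
  simp only [Pi.div_apply]
  rw [← Finset.mul_sum, mul_div_mul_left _ _ (by positivity)]
end

section
/- With the complete-graph setup below, for every index j, the j-th coordinate of the point of view of the whole graph at level m converges to P j as m → ∞; that is, the sequence m ↦ (1/n) · ∑ i, ( M_m i j / (∑ k, M_m i k) ) tends to P j as m → ∞. -/
open Filter

/-- Complete-graph setup: `n ≥ 2`, `P` a categorical distribution with positive entries,
`W i j = P j / (1 - P j)` for `i ≠ j` and `0` on the diagonal, `M_m = (I + W)^m - I`.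
Then for every `j`, the `j`-th coordinate of the point of view of the whole graph at
level `m`, namely `(1/n) · ∑ i, M_m i j / ∑ k, M_m i k`, tends to `P j` as `m → ∞`. -/
theorem pov_graph_tendsto_of_complete (n : ℕ) (hn : 2 ≤ n) (P : Fin n → ℝ)
    (hP : ∀ j, 0 < P j) (hPsum : ∑ j, P j = 1)
    (W : Matrix (Fin n) (Fin n) ℝ)
    (hW : ∀ i j, W i j = if i ≠ j then P j / (1 - P j) else 0)
    (j : Fin n) :
    Tendsto (fun m : ℕ =>
        (1 / (n : ℝ)) * ∑ i, (((1 + W) ^ m - 1) i j / ∑ k, ((1 + W) ^ m - 1) i k))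
      atTop (nhds (P j)) := by
  have hle : ∀ i j : Fin n, i ≠ j → P i + P j ≤ 1 := by
    intro i j hij
    rw [← hPsum, ← Finset.sum_pair hij]
    exact Finset.sum_le_sum_of_subset_of_nonneg (Finset.subset_univ _) (fun k _ _ => (hP k).le)
  have hlt : ∀ i, P i < 1 := by
    intro i
    have : Nontrivial (Fin n) := Fin.nontrivial_iff_two_le.mpr hn
    obtain ⟨k, hk⟩ := exists_ne i
    linarith [hle k i hk, hP k]
  have hv : ∀ i, 0 < 1 - P i := fun i => by linarith [hlt i]
  have : Nonempty (Fin n) := ⟨j⟩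
  obtain ⟨s, hs⟩ : ∃ s, s = ∑ k, P k * (1 - P k) := ⟨_, rfl⟩
  have hs0 : 0 < s := by
    rw [hs]
    exact Finset.sum_pos (fun k _ => mul_pos (hP k) (hv k)) Finset.univ_nonempty
  have hs1 : s ≤ 1 := by
    rw [hs, ← hPsum]
    exact Finset.sum_le_sum (fun k _ => by nlinarith [hP k])
  obtain ⟨Q, hQ⟩ : ∃ Q : Matrix (Fin n) (Fin n) ℝ, ∀ i j, Q i j = (1 - P i) * P j / s :=
    ⟨fun i j => (1 - P i) * P j / s, fun _ _ => rfl⟩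
  obtain ⟨B, hB⟩ : ∃ B : Matrix (Fin n) (Fin n) ℝ, B = (1 / 2 : ℝ) • (1 + W) := ⟨_, rfl⟩
  obtain ⟨c, hc⟩ : ∃ c : ℝ, c = 1 - s / 2 := ⟨_, rfl⟩
  obtain ⟨R, hR⟩ : ∃ R : Matrix (Fin n) (Fin n) ℝ, R = B - (1 - c) • Q := ⟨_, rfl⟩
  have hW' : ∀ i k, W i k = P k / (1 - P k) - (if i = k then P k / (1 - P k) else 0) := by
    intro i k
    rw [hW]
    by_cases h : i = k <;> simp [h]
  have hWv : ∀ i, ∑ k, W i k * (1 - P k) = 1 - P i := by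
    intro i
    have : ∀ k, W i k * (1 - P k) = P k - (if i = k then P k else 0) := by
      intro k
      have := (hv k).ne'
      rw [hW']
      split_ifs <;> field_simp <;> ring
    simp [this, Finset.sum_sub_distrib, hPsum]
  have hPW : ∀ k, ∑ i, P i * W i k = P k := by
    intro k
    have h0 := (hv k).ne'
    have : ∀ i, P i * W i k = P i * (P k / (1 - P k))
        - (if i = k then P k * (P k / (1 - P k)) else 0) := by
      intro i
      rw [hW']
      split_ifs with h
      · subst h; ring
      · ring
    simp only [this, Finset.sum_sub_distrib, ← Finset.sum_mul, hPsum]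
    simp
    field_simp
  have hBv : ∀ i, ∑ k, B i k * (1 - P k) = 1 - P i := by
    intro i
    have : ∀ k, B i k * (1 - P k) = (1 / 2) * ((if i = k then 1 - P k else 0)
        + W i k * (1 - P k)) := by
      intro k
      simp only [hB, Matrix.smul_apply, Matrix.add_apply, Matrix.one_apply, smul_eq_mul]
      split_ifs <;> ring
    simp only [this, ← Finset.mul_sum, Finset.sum_add_distrib, hWv]
    simp
    ring
  have hQv : ∀ i, ∑ k, Q i k * (1 - P k) = 1 - P i := by
    intro i
    have : ∀ k, Q i k * (1 - P k) = ((1 - P i) / s) * (P k * (1 - P k)) := by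
      intro k; rw [hQ]; ring
    simp only [this, ← Finset.mul_sum, ← hs]
    field_simp
  have hPB : ∀ k, ∑ i, P i * B i k = P k := by
    intro k
    have : ∀ i, P i * B i k = (1 / 2) * ((if i = k then P i else 0) + P i * W i k) := by
      intro i
      simp only [hB, Matrix.smul_apply, Matrix.add_apply, Matrix.one_apply, smul_eq_mul]
      split_ifs <;> ring
    simp only [this, ← Finset.mul_sum, Finset.sum_add_distrib, hPW]
    simp
    ring
  have hBQ : B * Q = Q := by
    ext i k
    rw [Matrix.mul_apply]
    have : ∀ l, B i l * Q l k = (B i l * (1 - P l)) * (P k / s) := by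
      intro l; rw [hQ]; ring
    simp only [this, ← Finset.sum_mul, hBv]
    rw [hQ]
    ring
  have hQQ : Q * Q = Q := by
    ext i k
    rw [Matrix.mul_apply]
    have : ∀ l, Q i l * Q l k = (Q i l * (1 - P l)) * (P k / s) := by
      intro l; rw [hQ l k]; ring
    simp only [this, ← Finset.sum_mul, hQv]
    rw [hQ]
    ring
  have hQB : Q * B = Q := by
    ext i k
    rw [Matrix.mul_apply]
    have : ∀ l, Q i l * B l k = ((1 - P i) / s) * (P l * B l k) := by
      intro l; rw [hQ]; ring
    simp only [this, ← Finset.mul_sum, hPB]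
    rw [hQ]
    ring
  have hRQ : R * Q = c • Q := by
    rw [hR, sub_mul, hBQ, smul_mul_assoc, hQQ]
    module
  have hQR : Q * R = c • Q := by
    rw [hR, mul_sub, hQB, mul_smul_comm, hQQ]
    module
  have hRmQ : ∀ m : ℕ, R ^ m * Q = c ^ m • Q := by
    intro m
    induction m with
    | zero => simp
    | succ m ih =>
      rw [pow_succ, mul_assoc, hRQ, mul_smul_comm, ih, smul_smul]
      congr 1; ring
  have hBR : B = R + (1 - c) • Q := by rw [hR]; abel
  have hBm : ∀ m : ℕ, B ^ m = R ^ m + (1 - c ^ m) • Q := by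
    intro m
    induction m with
    | zero => simp
    | succ m ih =>
      rw [pow_succ, ih]
      nth_rewrite 1 [hBR]
      rw [add_mul, mul_add, mul_add, mul_smul_comm, hRmQ, smul_mul_assoc, hQR, smul_mul_assoc,
        mul_smul_comm, hQQ, ← pow_succ]
      module
  have hR0 : ∀ i k, 0 ≤ R i k := by
    intro i k
    have h1 : R i k = (1 / 2) * ((1 : Matrix (Fin n) (Fin n) ℝ) i k + W i k - (1 - P i) * P k) := by
      simp only [hR, hB, hc, Matrix.sub_apply, Matrix.smul_apply, Matrix.add_apply, hQ, smul_eq_mul]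
      field_simp
      ring
    rw [h1, hW, Matrix.one_apply]
    by_cases h : i = k
    · subst h
      simp
      nlinarith [hP i, hlt i]
    · simp only [h, if_false, ne_eq, not_false_eq_true, if_true]
      have : P k ≤ P k / (1 - P k) := by
        rw [le_div_iff₀ (hv k)]
        nlinarith [hP k]
      nlinarith [mul_pos (hP i) (hP k)]
  have hRv : ∀ i, ∑ k, R i k * (1 - P k) = c * (1 - P i) := by
    intro i
    have : ∀ k, R i k * (1 - P k) = B i k * (1 - P k) - (1 - c) * (Q i k * (1 - P k)) := by
      intro k
      simp only [hR, Matrix.sub_apply, Matrix.smul_apply, smul_eq_mul]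
      ring
    simp only [this, Finset.sum_sub_distrib, ← Finset.mul_sum, hBv, hQv]
    ring
  have hRm : ∀ m : ℕ, (∀ i k, 0 ≤ (R ^ m) i k) ∧
      ∀ i, ∑ k, (R ^ m) i k * (1 - P k) = c ^ m * (1 - P i) := by
    intro m
    induction m with
    | zero =>
      refine ⟨fun i k => ?_, fun i => ?_⟩
      · rw [pow_zero, Matrix.one_apply]; split_ifs <;> norm_num
      · simp [Matrix.one_apply]
    | succ m ih =>
      refine ⟨fun i k => ?_, fun i => ?_⟩
      · rw [pow_succ, Matrix.mul_apply]
        exact Finset.sum_nonneg (fun l _ => mul_nonneg (ih.1 _ _) (hR0 _ _))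
      · simp only [pow_succ, Matrix.mul_apply, Finset.sum_mul]
        rw [Finset.sum_comm]
        have : ∀ l, ∑ k, (R ^ m) i l * R l k * (1 - P k) = c * ((R ^ m) i l * (1 - P l)) := by
          intro l
          simp only [mul_assoc, ← Finset.mul_sum, hRv]
          ring
        simp only [this, ← Finset.mul_sum, ih.2]
        ring
  have hcm : Tendsto (fun m : ℕ => c ^ m) atTop (nhds 0) :=
    tendsto_pow_atTop_nhds_zero_of_lt_one (by linarith) (by linarith)
  have hRlim : ∀ i k, Tendsto (fun m : ℕ => (R ^ m) i k) atTop (nhds 0) := by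
    intro i k
    have hg : Tendsto (fun m : ℕ => c ^ m * ((1 - P i) / (1 - P k))) atTop (nhds 0) := by
      simpa using hcm.mul_const ((1 - P i) / (1 - P k))
    refine squeeze_zero (fun m => (hRm m).1 i k) (fun m => ?_) hg
    rw [← mul_div_assoc, le_div_iff₀ (hv k), ← (hRm m).2 i]
    exact Finset.single_le_sum (f := fun k => (R ^ m) i k * (1 - P k))
      (fun l _ => mul_nonneg ((hRm m).1 i l) (hv l).le) (Finset.mem_univ k)
  have hBlim : ∀ i k, Tendsto (fun m : ℕ => (B ^ m) i k) atTop (nhds (Q i k)) := by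
    intro i k
    have := (hRlim i k).add ((hcm.const_sub 1).mul_const (Q i k))
    simp only [sub_zero, one_mul, zero_add] at this
    refine this.congr (fun m => ?_)
    rw [hBm]
    simp
  have h2 : Tendsto (fun m : ℕ => (1 / 2 : ℝ) ^ m) atTop (nhds 0) :=
    tendsto_pow_atTop_nhds_zero_of_lt_one (by norm_num) (by norm_num)
  have hMlim : ∀ i k, Tendsto (fun m : ℕ => (1 / 2 : ℝ) ^ m * ((1 + W) ^ m - 1) i k) atTop
      (nhds (Q i k)) := by
    intro i k
    have := (hBlim i k).sub (h2.mul_const ((1 : Matrix (Fin n) (Fin n) ℝ) i k))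
    simp only [sub_zero, zero_mul] at this
    refine this.congr (fun m => ?_)
    rw [hB, smul_pow]
    simp only [Matrix.sub_apply, Matrix.smul_apply, smul_eq_mul]
    ring
  have hQsum : ∀ i, ∑ k, Q i k = (1 - P i) / s := by
    intro i
    have : ∀ k, Q i k = ((1 - P i) / s) * P k := by
      intro k; rw [hQ]; ring
    simp only [this, ← Finset.mul_sum, hPsum, mul_one]
  have hrow : ∀ i, Tendsto (fun m : ℕ => ((1 + W) ^ m - 1) i j / ∑ k, ((1 + W) ^ m - 1) i k) atTop
      (nhds (P j)) := by
    intro i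
    have h0 := (hv i).ne'
    have hd := tendsto_finsetSum Finset.univ (fun k _ => hMlim i k)
    have := (hMlim i j).div hd (by rw [hQsum]; exact (div_pos (hv i) hs0).ne')
    rw [hQsum, hQ] at this
    have he : (1 - P i) * P j / s / ((1 - P i) / s) = P j := by field_simp
    rw [he] at this
    refine this.congr (fun m => ?_)
    simp only [Pi.div_apply]
    rw [← Finset.mul_sum, mul_div_mul_left _ _ (by positivity)]
  have hfin := (tendsto_finsetSum Finset.univ (fun i _ => hrow i)).const_mul (1 / (n : ℝ))
  have hn0 : (n : ℝ) ≠ 0 := by positivity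
  have he : (1 / (n : ℝ)) * ∑ _i : Fin n, P j = P j := by
    simp
    field_simp
  rw [he] at hfin
  exact hfin
end

section
/- Let G and H be simple graphs on finite vertex types V and U respectively. Then G and H are isomorphic as graphs (there exists a graph isomorphism G ≃g H) if and only if the path categories Paths Q_G and Paths Q_H are isomorphic as categories (there exist functors F : Paths Q_G ⥤ Paths Q_H and R : Paths Q_H ⥤ Paths Q_G with F ⋙ R and R ⋙ F equal to the identity functors). -/
open CategoryTheory

/-- The quiver associated to a simple graph `G`: same vertices, and exactly one arrow
`u ⟶ v` iff `u` and `v` are adjacent. -/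
def GraphQuiver {V : Type*} (G : SimpleGraph V) : Type _ := V

instance {V : Type*} (G : SimpleGraph V) : Quiver (GraphQuiver G) :=
  ⟨fun u v => PLift (G.Adj (u : V) (v : V))⟩

/-- Length of a morphism in the path category. -/
def glen {V : Type*} {G : SimpleGraph V} {a b : Paths (GraphQuiver G)} (p : a ⟶ b) : ℕ :=
  Quiver.Path.length (V := GraphQuiver G) p

theorem glen_comp {V : Type*} {G : SimpleGraph V} {a b c : Paths (GraphQuiver G)}
    (p : a ⟶ b) (q : b ⟶ c) : glen (p ≫ q) = glen p + glen q :=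
  Quiver.Path.length_comp (V := GraphQuiver G) p q

theorem glen_id {V : Type*} {G : SimpleGraph V} (a : Paths (GraphQuiver G)) :
    glen (𝟙 a) = 0 := rfl

theorem glen_eqToHom {V : Type*} {G : SimpleGraph V} {a b : Paths (GraphQuiver G)}
    (h : a = b) : glen (eqToHom h) = 0 := by
  subst h; rfl

/-- The edge as a morphism in the path category. -/
def gedge {V : Type*} {G : SimpleGraph V} {a b : V} (h : G.Adj a b) :
    @Quiver.Hom (Paths (GraphQuiver G)) _ a b :=
  Quiver.Hom.toPath (V := GraphQuiver G) (a := a) (b := b) ⟨h⟩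

theorem glen_gedge {V : Type*} {G : SimpleGraph V} {a b : V} (h : G.Adj a b) :
    glen (gedge h) = 1 := rfl

theorem eq_of_glen_zero {V : Type*} {G : SimpleGraph V} {a b : Paths (GraphQuiver G)}
    (p : a ⟶ b) (h : glen p = 0) : a = b :=
  Quiver.Path.eq_of_length_zero (V := GraphQuiver G) p h

theorem adj_of_glen_one {V : Type*} {G : SimpleGraph V} {a b : Paths (GraphQuiver G)}
    (p : a ⟶ b) (h : glen p = 1) : ∃ e : G.Adj a b, p = gedge e := by
  change Quiver.Path (V := GraphQuiver G) a b at p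
  cases p with
  | nil => cases h
  | cons q e =>
    have h0 : Quiver.Path.length (V := GraphQuiver G) q = 0 := Nat.succ.inj h
    cases q with
    | nil => exact ⟨e.down, rfl⟩
    | cons q f => cases h0

theorem le_glen_map {V U : Type*} {G : SimpleGraph V} {H : SimpleGraph U}
    (F : Paths (GraphQuiver G) ⥤ Paths (GraphQuiver H)) (hF : Function.Injective F.obj)
    {a b : Paths (GraphQuiver G)} (p : a ⟶ b) : glen p ≤ glen (F.map p) := by
  change Quiver.Path (V := GraphQuiver G) a b at p
  induction p with
  | nil => exact Nat.zero_le _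
  | @cons b c q e ih =>
    have h1 : glen (F.map (gedge e.down)) ≠ 0 := fun h =>
      G.ne_of_adj e.down (hF (eq_of_glen_zero _ h))
    have h2 : F.map (Quiver.Path.cons q e) = F.map q ≫ F.map (gedge e.down) :=
      F.map_comp (X := a) (Y := b) (Z := c) q (gedge e.down)
    have h3 : glen (F.map (Quiver.Path.cons q e)) = glen (F.map q) + glen (F.map (gedge e.down)) := by
      rw [h2]; exact glen_comp _ _
    have h4 : glen (G := G) (a := a) (b := c) (Quiver.Path.cons q e) = glen (G := G) (a := a) (b := b) q + 1 := rfl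
    refine h4.le.trans (le_trans ?_ h3.ge)
    exact Nat.add_le_add ih (Nat.one_le_iff_ne_zero.2 h1)

theorem glen_map_of_eq_id {V : Type*} {G : SimpleGraph V}
    (K : Paths (GraphQuiver G) ⥤ Paths (GraphQuiver G)) (hK : K = 𝟭 _)
    {a b : Paths (GraphQuiver G)} (p : a ⟶ b) : glen (K.map p) = glen p := by
  subst hK; rfl

theorem adj_map {V U : Type*} {G : SimpleGraph V} {H : SimpleGraph U}
    (F : Paths (GraphQuiver G) ⥤ Paths (GraphQuiver H))
    (R : Paths (GraphQuiver H) ⥤ Paths (GraphQuiver G))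
    (hF : Function.Injective F.obj) (hR : Function.Injective R.obj)
    (h : F ⋙ R = 𝟭 _) {a b : V} (e : G.Adj a b) : H.Adj (F.obj a) (F.obj b) := by
  have h1 := le_glen_map F hF (gedge e)
  have h2 := le_glen_map R hR (F.map (gedge e))
  have h3 := glen_map_of_eq_id _ h (gedge e)
  rw [glen_gedge] at h1 h3
  have h4 : glen (R.map (F.map (gedge e))) = 1 := h3
  exact (adj_of_glen_one _ (le_antisymm (h4 ▸ h2) h1)).1

/-- Functor induced by a graph isomorphism. -/
def gfun {V U : Type*} {G : SimpleGraph V} {H : SimpleGraph U} (f : G ≃g H) :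
    Paths (GraphQuiver G) ⥤ Paths (GraphQuiver H) :=
  Paths.lift (V := GraphQuiver G)
    { obj := fun a => f a
      map := fun {a b} e => gedge (G := H) (a := f a) (b := f b) (f.map_rel_iff.2 e.down) }

theorem gfun_gedge {V U : Type*} {G : SimpleGraph V} {H : SimpleGraph U} (f : G ≃g H)
    {a b : V} (e : G.Adj a b) :
    (gfun f).map (gedge e) = gedge (G := H) (a := f a) (b := f b) (f.map_rel_iff.2 e) :=
  Paths.lift_toPath (V := GraphQuiver G) _ _

theorem gfun_comp {V U : Type*} {G : SimpleGraph V} {H : SimpleGraph U} (f : G ≃g H)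
    (g : H ≃g G) (hfg : ∀ x, g (f x) = x) :
    gfun f ⋙ gfun g = 𝟭 (Paths (GraphQuiver G)) := by
  refine Paths.ext_functor (funext fun x => hfg x) ?_
  intro a b e
  have key : ∀ p q : @Quiver.Hom (Paths (GraphQuiver G)) _ (g (f a)) (g (f b)),
      glen p = 1 → glen q = 1 → p = q := by
    intro p q hp hq
    obtain ⟨_, rfl⟩ := adj_of_glen_one p hp
    obtain ⟨_, rfl⟩ := adj_of_glen_one q hq
    rfl
  refine key _ _ ?_ ?_
  · change glen ((gfun g).map ((gfun f).map (gedge e.down))) = 1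
    exact (congrArg (fun p => glen ((gfun g).map p)) (gfun_gedge f e.down)).trans
      (congrArg glen (gfun_gedge g _))
  · refine (glen_comp _ _).trans ?_
    have h1 : glen (gedge e.down) = 1 := rfl
    exact congrArg₂ (· + ·) (glen_eqToHom _)
      ((glen_comp _ _).trans (congrArg₂ (· + ·) h1 (glen_eqToHom _)))

/-- Two simple graphs on finite vertex types are isomorphic iff the path categories of
their associated quivers are isomorphic as categories. -/
theorem graph_iso_iff_paths_cat_iso {V U : Type*} [Fintype V] [Fintype U]
    (G : SimpleGraph V) (H : SimpleGraph U) :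
    Nonempty (G ≃g H) ↔
      ∃ (F : Paths (GraphQuiver G) ⥤ Paths (GraphQuiver H))
        (R : Paths (GraphQuiver H) ⥤ Paths (GraphQuiver G)),
        F ⋙ R = 𝟭 (Paths (GraphQuiver G)) ∧ R ⋙ F = 𝟭 (Paths (GraphQuiver H)) := by
  constructor
  · rintro ⟨f⟩
    exact ⟨gfun f, gfun f.symm, gfun_comp _ _ (fun x => f.symm_apply_apply x),
      gfun_comp _ _ (fun x => f.apply_symm_apply x)⟩
  · rintro ⟨F, R, h1, h2⟩
    have l : Function.LeftInverse R.obj F.obj := fun x => Functor.congr_obj h1 x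
    have r : Function.LeftInverse F.obj R.obj := fun x => Functor.congr_obj h2 x
    refine ⟨⟨⟨F.obj, R.obj, l, r⟩, ?_⟩⟩
    intro a b
    refine ⟨fun h => ?_, fun h => adj_map F R l.injective r.injective h1 h⟩
    have h3 : G.Adj (R.obj (F.obj a)) (R.obj (F.obj b)) :=
      adj_map R F r.injective l.injective h2 h
    rw [l a, l b] at h3
    exact h3
end

section
/- Let G and H be simple graphs on vertex types V and U, and let F : Paths Q_G ⥤ Paths Q_H and R : Paths Q_H ⥤ Paths Q_G be functors with F ⋙ R and R ⋙ F equal to the identity functors. Then F maps every length-one morphism to a length-one morphism: for every arrow e of Q_G (i.e., every pair of adjacent vertices u, v of G with its single arrow), the quiver path F.map (e.toPath) has length 1. -/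
open CategoryTheory

theorem aux_length_id {A : Type*} [Quiver A] (S : Paths A ⥤ Paths A) (hS : S = 𝟭 (Paths A))
    {a b : A} (p : Quiver.Path a b) :
    Quiver.Path.length (S.map (X := a) (Y := b) p) = p.length := by
  subst hS
  rfl

theorem aux_length_zero {A B : Type*} [Quiver A] [Quiver B] (S : Paths A ⥤ Paths B)
    {a b : A} (p : Quiver.Path a b) (hp : p.length = 0) :
    Quiver.Path.length (S.map (X := a) (Y := b) p) = 0 := by
  cases p with
  | nil =>
    have := S.map_id a
    exact (congrArg Quiver.Path.length this)
  | cons p e => simp at hp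

theorem aux_length_le {A B : Type*} [Quiver A] [Quiver B] (S : Paths A ⥤ Paths B)
    (T : Paths B ⥤ Paths A) (hST : S ⋙ T = 𝟭 (Paths A))
    {a b : A} (p : Quiver.Path a b) :
    p.length ≤ Quiver.Path.length (S.map (X := a) (Y := b) p) := by
  induction p with
  | nil => simp
  | @cons b c p e ih =>
    have h0 : Quiver.Path.length (S.map (X := b) (Y := c) e.toPath) ≠ 0 := by
      intro h
      have h1 := aux_length_zero T _ h
      have h2 := aux_length_id _ hST e.toPath
      have h3 : Quiver.Path.length e.toPath = 1 := rfl
      have h4 := h1.symm.trans h2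
      omega
    have hc := congrArg Quiver.Path.length (@Functor.map_comp _ _ _ _ S a b c p e.toPath)
    have hd := hc.trans (Quiver.Path.length_comp _ _)
    have he : Quiver.Path.length (S.map (X := a) (Y := c) (p.cons e)) = _ := hd
    rw [he, Quiver.Path.length_cons]
    omega

/-- If `F : Paths Q_G ⥤ Paths Q_H` is part of an isomorphism of path categories, then `F`
maps every length-one morphism (the path of a single arrow coming from an adjacency of `G`)
to a length-one path. -/
theorem functor_map_edge_length_one {V U : Type*}
    (G : SimpleGraph V) (H : SimpleGraph U)
    (F : Paths (GraphQuiver G) ⥤ Paths (GraphQuiver H))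
    (R : Paths (GraphQuiver H) ⥤ Paths (GraphQuiver G))
    (h1 : F ⋙ R = 𝟭 (Paths (GraphQuiver G)))
    (h2 : R ⋙ F = 𝟭 (Paths (GraphQuiver H)))
    (u v : GraphQuiver G) (h : G.Adj (u : V) (v : V)) :
    Quiver.Path.length (F.map (Quiver.Hom.toPath (⟨h⟩ : u ⟶ v))) = 1 := by
  have a1 := aux_length_le F R h1 (Quiver.Hom.toPath (⟨h⟩ : u ⟶ v))
  have a2 := aux_length_le R F h2 (F.map (Quiver.Hom.toPath (⟨h⟩ : u ⟶ v)))
  have a3 := a2.trans_eq (aux_length_id _ h1 (Quiver.Hom.toPath (⟨h⟩ : u ⟶ v)))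
  exact le_antisymm a3 a1
end
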